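/- Let (D, p, p) be a finite metric voting instance in general position in which the candidate distribution equals the voter distribution. Let δ ≤ 1/100 and suppose the maximum pairwise distortion equals 3 − δ, i.e., max over pairs (i,j) of cost(W(i,j))/cost(opt(i,j)) = 3 − δ. Then the expected distortion satisfies Social(D, p, p) ≤ 3/2 + 9·√δ. -/

import Mathlib

open Finset

/-- A finite metric space on `n` points. -/
structure FinMetric (n : ℕ) where
  d : Fin n → Fin n → ℝ
  refl : ∀ i, d i i = 0
  symm : ∀ i j, d i j = d j i
  pos : ∀ i j, i ≠ j → 0 < d i j
  triangle : ∀ i j k, d i k ≤ d i j + d j k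

/-- Social cost of candidate `i`: average distance to the voters,
distributed according to `q`. -/
noncomputable def mcost {n : ℕ} (M : FinMetric n) (q : Fin n → ℝ) (i : Fin n) : ℝ :=
  ∑ j, q j * M.d i j

/-- Total voter mass strictly preferring candidate `i` over candidate `i'`. -/
noncomputable def mvotes {n : ℕ} (M : FinMetric n) (q : Fin n → ℝ) (i i' : Fin n) : ℝ :=
  ∑ j ∈ Finset.univ.filter (fun j => M.d i j < M.d i' j), q j

/-- The majority winner of the election between candidates `i` and `i'`. -/
noncomputable def mwin {n : ℕ} (M : FinMetric n) (q : Fin n → ℝ) (i i' : Fin n) : Fin n :=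
  if 1/2 < mvotes M q i i' then i else i'

/-- The socially better of the two candidates `i`, `i'`. -/
noncomputable def mopt {n : ℕ} (M : FinMetric n) (q : Fin n → ℝ) (i i' : Fin n) : Fin n :=
  if mcost M q i < mcost M q i' then i else i'

/-- Pairwise distortion of the election between `i` and `i'`. -/
noncomputable def mr {n : ℕ} (M : FinMetric n) (q : Fin n → ℝ) (i i' : Fin n) : ℝ :=
  mcost M q (mwin M q i i') / mcost M q (mopt M q i i')

/-- Expected distortion: two candidates drawn i.i.d. from `p`, voters distributed as `q`. -/
noncomputable def msocial {n : ℕ} (M : FinMetric n) (p q : Fin n → ℝ) : ℝ :=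
  ∑ i, ∑ i', p i * p i' * mr M q i i'

/-- General position: no voter is equidistant from two distinct candidates, every
election has a strict majority winner, and there are no ties in social cost. -/
def MGenPos {n : ℕ} (M : FinMetric n) (q : Fin n → ℝ) : Prop :=
  (∀ j i i' : Fin n, i ≠ i' → M.d i j ≠ M.d i' j) ∧
  (∀ i i' : Fin n, i ≠ i' → mvotes M q i i' ≠ 1/2) ∧
  (∀ i i' : Fin n, i ≠ i' → mcost M q i ≠ mcost M q i')

lemma aux_ratio1 (c m e g : ℝ) (he : 0 ≤ e) (he' : e ≤ 1/500) (hg : 0 ≤ g)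
    (hm : 1/4 - e ≤ m) (hc : c ≤ 1/4 + e + g) : c / m ≤ 1 + 12 * e + 5 * g := by
  have hm0 : 0 < m := by linarith
  rw [div_le_iff₀ hm0]
  have : (1 + 12 * e + 5 * g) * (1/4 - e) ≤ (1 + 12 * e + 5 * g) * m :=
    mul_le_mul_of_nonneg_left hm (by positivity)
  nlinarith [mul_nonneg he hg, mul_le_mul_of_nonneg_left he' he, mul_le_mul_of_nonneg_right he' hg]

lemma aux_ratio2 (c m e g : ℝ) (he : 0 ≤ e) (he' : e ≤ 1/500) (hg : 0 ≤ g) (hc0 : 0 ≤ c)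
    (hm : 1/4 - e ≤ m) (hc : c ≤ 3/4 + e + g) : c / m ≤ 4 * c + 16 * e + g := by
  have hm0 : 0 < m := by linarith
  rw [div_le_iff₀ hm0]
  have : (4 * c + 16 * e + g) * (1/4 - e) ≤ (4 * c + 16 * e + g) * m :=
    mul_le_mul_of_nonneg_left hm (by positivity)
  nlinarith [mul_nonneg he hg, mul_le_mul_of_nonneg_left he' he, mul_le_mul_of_nonneg_right he' hg,
    mul_le_mul_of_nonneg_left hc he]

noncomputable def zc (c : ℝ) : ℝ := max 1 (min 3 (4 * c))
noncomputable def ph (c : ℝ) : ℝ := min (zc c) (4 - zc c)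

lemma zc_ge (c : ℝ) : 1 ≤ zc c := le_max_left _ _
lemma zc_le (c : ℝ) : zc c ≤ 3 := max_le (by norm_num) (min_le_left _ _)
lemma ph_ge (c : ℝ) : 1 ≤ ph c := le_min (zc_ge c) (by linarith [zc_le c])
lemma ph_le (c : ℝ) : ph c ≤ 2 := by
  unfold ph
  rcases le_total (zc c) 2 with h | h
  · exact (min_le_left _ _).trans h
  · exact (min_le_right _ _).trans (by linarith)

lemma aux_main (a b : ℝ) (ha : 1 ≤ a) (ha' : a ≤ 3) (hb : 1 ≤ b) (hb' : b ≤ 3) :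
    a / b + min a (4 - a) + min b (4 - b) ≤ 5 := by
  have hb0 : 0 < b := by linarith
  have h1 := min_le_left a (4 - a)
  have h2 := min_le_right a (4 - a)
  have h3 := min_le_left b (4 - b)
  have h4 := min_le_right b (4 - b)
  suffices a / b ≤ 5 - min a (4 - a) - min b (4 - b) by linarith
  rw [div_le_iff₀ hb0]
  rcases le_total a b with h | h
  · nlinarith
  · rcases le_total a 2 with h5 | h5 <;> rcases le_total b 2 with h6 | h6
    · have : (5 - a - b) * b ≤ (5 - min a (4 - a) - min b (4 - b)) * b :=
        mul_le_mul_of_nonneg_right (by linarith) hb0.le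
      nlinarith [mul_nonneg (sub_nonneg.2 hb) (sub_nonneg.2 h), mul_nonneg (sub_nonneg.2 hb) (sub_nonneg.2 h5)]
    · nlinarith
    · have : (5 - (4 - a) - b) * b ≤ (5 - min a (4 - a) - min b (4 - b)) * b :=
        mul_le_mul_of_nonneg_right (by linarith) hb0.le
      nlinarith [mul_nonneg (sub_nonneg.2 hb) (sub_nonneg.2 h5), mul_nonneg (sub_nonneg.2 hb) (sub_nonneg.2 h6)]
    · have : (5 - (4 - a) - (4 - b)) * b ≤ (5 - min a (4 - a) - min b (4 - b)) * b :=
        mul_le_mul_of_nonneg_right (by linarith) hb0.le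
      nlinarith [mul_nonneg (sub_nonneg.2 hb) (sub_nonneg.2 h5), mul_nonneg (sub_nonneg.2 h5) (sub_nonneg.2 h6)]

lemma aux_BB (c c' e g : ℝ) (he : 0 ≤ e) (he' : e ≤ 1/500) (hg : 0 ≤ g)
    (hc : c ≤ 3/4 + e + g) (h1 : 1/4 - e ≤ c) (h2 : 1/4 - e ≤ c') :
    c / min c c' ≤ 5 - ph c - ph c' + 20 * e + 5 * g := by
  have hp := ph_le c
  have hp' := ph_le c'
  rcases le_total c c' with h | h
  · rw [min_eq_left h, div_self (by linarith)]
    linarith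
  rw [min_eq_right h]
  have hc0 : 0 < c' := by linarith
  have m := aux_main (zc c) (zc c') (zc_ge _) (zc_le _) (zc_ge _) (zc_le _)
  change zc c / zc c' + ph c + ph c' ≤ 5 at m
  suffices c / c' ≤ zc c / zc c' + 20 * e + 5 * g by linarith
  have z1 := zc_ge c
  have z1' := zc_ge c'
  have u : 4 * c ≤ zc c + 4 * e + 4 * g := by
    unfold zc
    rcases le_total 3 (4 * c) with q | q
    · rw [min_eq_left q]; have := le_max_right (1:ℝ) 3; linarith
    · rw [min_eq_right q]; have := le_max_right (1:ℝ) (4*c); linarith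
  have l : zc c' * (1 - 4 * e) ≤ 4 * c' := by
    rcases le_total 1 (4 * c') with q | q
    · have : zc c' ≤ 4 * c' := max_le q (min_le_right _ _)
      nlinarith
    · have : zc c' ≤ 1 := max_le le_rfl ((min_le_right _ _).trans q)
      nlinarith
  rw [div_le_iff₀ hc0]
  set T := zc c / zc c' with hT
  have hT0 : 0 ≤ T := div_nonneg (by linarith) (by linarith)
  have hT1 : zc c = T * zc c' := by rw [hT]; field_simp
  have hT3 : T ≤ 3 := by
    rw [hT, div_le_iff₀ (by linarith)]; nlinarith [zc_le c]
  have k1 : (T + 20 * e + 5 * g) * (zc c' * (1 - 4 * e)) ≤ (T + 20 * e + 5 * g) * (4 * c') :=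
    mul_le_mul_of_nonneg_left l (by positivity)
  have k2 : T + 4 * e + 4 * g ≤ (T + 20 * e + 5 * g) * (1 - 4 * e) := by
    nlinarith [mul_le_mul_of_nonneg_left hT3 he, mul_le_mul_of_nonneg_left he' he, mul_le_mul_of_nonneg_right he' hg]
  have k3 : (T + 4 * e + 4 * g) * zc c' ≤ (T + 20 * e + 5 * g) * (1 - 4 * e) * zc c' :=
    mul_le_mul_of_nonneg_right k2 (by linarith)
  nlinarith [mul_nonneg he (sub_nonneg.2 z1'), mul_nonneg hg (sub_nonneg.2 z1')]

/-- candidate j wins against i: then `4c ≤ ph c + 2 s`. -/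
lemma aux_ph (c s : ℝ) (hs : 0 ≤ s) (h : 4 * c ≤ 2 + s) : 4 * c ≤ ph c + 2 * s := by
  unfold ph zc
  rcases le_total 3 (4 * c) with q | q
  · rw [min_eq_left q]; norm_num; linarith
  · rw [min_eq_right q]
    rcases le_total 1 (4 * c) with q' | q'
    · rw [max_eq_right q']
      rcases le_total (4*c) 2 with w | w
      · rw [min_eq_left (by linarith)]; linarith
      · rw [min_eq_right (by linarith)]; linarith
    · rw [max_eq_left q']; norm_num; linarith

lemma core {n : ℕ} (d : Fin n → Fin n → ℝ) (p c : Fin n → ℝ) (r : Fin n → Fin n → ℝ)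
    (hp : ∀ i, 0 ≤ p i) (hpsum : ∑ i, p i = 1)
    (dnn : ∀ i j, 0 ≤ d i j) (dsymm : ∀ i j, d i j = d j i)
    (tri : ∀ i j k, d i k ≤ d i j + d j k)
    (hc : ∀ i, c i = ∑ j, p j * d i j)
    (hr3 : ∀ i j, r i j ≤ 3)
    (hW : ∀ i j, (r i j = c i / min (c i) (c j) ∧ 1/2 ≤ ∑ v, p v * (if d i v ≤ d j v then (1:ℝ) else 0)) ∨
      (r i j = c j / min (c i) (c j) ∧ 1/2 ≤ ∑ v, p v * (if d j v ≤ d i v then (1:ℝ) else 0)))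
    (A B : Fin n) (hAB : d A B = 1) (δ : ℝ) (hδ0 : 0 ≤ δ) (hδ : δ ≤ 1/100)
    (hcB : c B = (3 - δ) * c A)
    (hb : 1/2 ≤ ∑ v, p v * (if d B v ≤ d A v then (1:ℝ) else 0)) :
    ∑ i, ∑ j, p i * p j * r i j ≤ 3/2 + 9 * Real.sqrt δ := by
  obtain ⟨s, hs⟩ : ∃ s : Fin n → ℝ, s = fun v => if d B v ≤ d A v then (1:ℝ) else 0 := ⟨_, rfl⟩
  obtain ⟨g, hg⟩ : ∃ g : Fin n → ℝ, g = fun v => d A v - s v / 2 := ⟨_, rfl⟩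
  have hdA : ∀ v, d A v = g v + s v / 2 := fun v => by rw [hg]; ring
  have hs01 : ∀ v, s v = 0 ∨ (s v = 1 ∧ d B v ≤ d A v) := by
    intro v; rw [hs]; by_cases h : d B v ≤ d A v <;> simp [h]
  have hg0 : ∀ v, 0 ≤ g v := by
    intro v
    have h1 := hdA v
    rcases hs01 v with h | ⟨h, h'⟩
    · have := dnn A v; rw [h] at h1; linarith
    · have := tri A v B
      rw [hAB, dsymm v B] at this
      rw [h] at h1; linarith
  obtain ⟨b, hbd⟩ : ∃ b, b = ∑ v, p v * s v := ⟨_, rfl⟩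
  obtain ⟨G, hG⟩ : ∃ G, G = ∑ v, p v * g v := ⟨_, rfl⟩
  have hb2 : 1/2 ≤ b := by rw [hbd, hs]; exact hb
  have hG0 : 0 ≤ G := by rw [hG]; exact Finset.sum_nonneg fun v _ => mul_nonneg (hp v) (hg0 v)
  -- comparison of sums
  have sumle : ∀ (f : Fin n → ℝ) (x y z : ℝ), (∀ v, f v ≤ x + y * s v + z * g v) →
      ∑ v, p v * f v ≤ x + y * b + z * G := by
    intro f x y z h
    calc ∑ v, p v * f v ≤ ∑ v, p v * (x + y * s v + z * g v) :=
          Finset.sum_le_sum fun v _ => mul_le_mul_of_nonneg_left (h v) (hp v)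
      _ = (∑ v, p v) * x + y * (∑ v, p v * s v) + z * (∑ v, p v * g v) := by
          rw [Finset.sum_mul, Finset.mul_sum, Finset.mul_sum, ← Finset.sum_add_distrib,
            ← Finset.sum_add_distrib]
          exact Finset.sum_congr rfl fun v _ => by ring
      _ = _ := by rw [hpsum, hbd, hG]; ring
  have sumge : ∀ (f : Fin n → ℝ) (x y z : ℝ), (∀ v, x + y * s v + z * g v ≤ f v) →
      x + y * b + z * G ≤ ∑ v, p v * f v := by
    intro f x y z h
    have := sumle (fun v => - f v) (-x) (-y) (-z) (fun v => by have := h v; linarith)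
    simp only [mul_neg, Finset.sum_neg_distrib] at this
    linarith
  have hcA : c A = G + b / 2 := by
    rw [hc]
    apply le_antisymm
    · have := sumle (d A) 0 (1/2) 1 (fun v => by rw [hdA]; linarith)
      linarith
    · have := sumge (d A) 0 (1/2) 1 (fun v => by rw [hdA]; linarith)
      linarith
  have hcB' : c B ≤ 3 * c A - (2 * G + 2 * b - 1) := by
    have := sumle (d B) 1 (-1/2) 1 (fun v => by
      have h1 := hdA v
      rcases hs01 v with h | ⟨h, h'⟩
      · have := tri B A v
        rw [dsymm B A, hAB] at this
        rw [h] at h1 ⊢; linarith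
      · rw [h] at h1 ⊢; linarith)
    rw [← hc B] at this
    linarith
  obtain ⟨e, he⟩ : ∃ e, e = (b - 1/2) + G := ⟨_, rfl⟩
  have he0 : 0 ≤ e := by linarith
  have heδ : e ≤ δ / 7 := by
    rw [hcA] at hcB hcB'
    nlinarith
  have he' : e ≤ 1/500 := by linarith
  have hcApos : c A ≤ 1/4 + e := by linarith
  -- upper bound on costs
  have cup : ∀ i, c i ≤ 1/4 + e + g i + s i / 2 := by
    intro i
    have := sumle (d i) (d A i) (1/2) 1 (fun v => by
      have := tri i A v
      rw [dsymm i A] at this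
      have := hdA v
      linarith)
    rw [← hc i, hdA i] at this
    linarith
  have clowB : ∀ i, s i = 1 → 1/4 - e ≤ c i := by
    intro i hi
    have := sumge (d i) (1/2) (-1/2) (-1) (fun v => by
      have h1 := hdA v
      have h2 := hdA i
      have h3 := tri A v i
      rw [dsymm v i] at h3
      have := dnn i v
      have := hg0 i
      have := hg0 v
      rcases hs01 v with h | ⟨h, h'⟩ <;> rw [h] at h1 ⊢ <;> rw [hi] at h2 <;> linarith)
    rw [← hc i] at this
    linarith
  have clowA : ∀ i, s i = 0 → g i ≤ 1/4 → 1/4 - e ≤ c i := by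
    intro i hi hgi
    have := sumge (d i) (g i) (1/2 - 2 * g i) (-1) (fun v => by
      have h1 := hdA v
      have h2 := hdA i
      have h3 := tri A v i
      have h4 := tri A i v
      rw [dsymm v i] at h3
      have := hg0 i
      have := hg0 v
      rcases hs01 v with h | ⟨h, h'⟩ <;> rw [h] at h1 ⊢ <;> rw [hi] at h2 <;> linarith)
    rw [← hc i] at this
    nlinarith [hg0 i]
  -- j in Bv beating i in Av
  have win : ∀ i j, s i = 0 → g i ≤ 1/4 → s j = 1 →
      1/2 ≤ ∑ v, p v * (if d j v ≤ d i v then (1:ℝ) else 0) → c j ≤ 1/2 + g j + g i + 5 * e := by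
    intro i j hi hgi hj hv
    have := sumle (fun v => d j v + (if d j v ≤ d i v then (1:ℝ) else 0) / 2)
        (1/2 + g j + g i) (1/2) 5 (fun v => by
      have h1 := hdA v
      have h2 := hdA i
      have h3 := hdA j
      have h4 := tri j A v
      have h5 := tri A v j
      have h6 := tri i A v
      rw [dsymm v j] at h5
      rw [dsymm j A] at h4
      rw [dsymm i A] at h6
      rw [hi] at h2
      rw [hj] at h3
      have := hg0 i
      have := hg0 j
      have := hg0 v
      show d j v + (if d j v ≤ d i v then (1:ℝ) else 0) / 2 ≤ _
      split_ifs with hh <;> rcases hs01 v with h | ⟨h, h'⟩ <;> rw [h] at h1 ⊢ <;> linarith)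
    have e1 : ∑ v, p v * (d j v + (if d j v ≤ d i v then (1:ℝ) else 0) / 2)
       = c j + (∑ v, p v * (if d j v ≤ d i v then (1:ℝ) else 0)) / 2 := by
      rw [hc j, Finset.sum_div, ← Finset.sum_add_distrib]
      exact Finset.sum_congr rfl fun v _ => by ring
    rw [e1] at this
    linarith
  -- pair bounds
  have rAA : ∀ i j, s i = 0 → s j = 0 → r i j ≤ 1 + 100 * e + 20 * (g i + g j) := by
    intro i j hi hj
    have gi := hg0 i
    have gj := hg0 j
    have h3 := hr3 i j
    by_cases h1 : g i ≤ 1/4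
    swap
    · push Not at h1; linarith
    by_cases h2 : g j ≤ 1/4
    swap
    · push Not at h2; linarith
    have hm := le_min (clowA i hi h1) (clowA j hj h2)
    have ui := cup i
    have uj := cup j
    rw [hi] at ui
    rw [hj] at uj
    rcases hW i j with ⟨h, -⟩ | ⟨h, -⟩
    · have := aux_ratio1 (c i) _ e (g i) he0 he' gi hm (by linarith)
      linarith
    · have := aux_ratio1 (c j) _ e (g j) he0 he' gj hm (by linarith)
      linarith
  have rAB0 : ∀ i j, s i = 0 → s j = 1 → ∀ R, R ≤ 3 →
      ((R = c i / min (c i) (c j)) ∨ (R = c j / min (c i) (c j) ∧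
        1/2 ≤ ∑ v, p v * (if d j v ≤ d i v then (1:ℝ) else 0))) →
      R ≤ ph (c j) + 100 * e + 20 * (g i + g j) := by
    intro i j hi hj R hR hor
    have gi := hg0 i
    have gj := hg0 j
    have hph := ph_ge (c j)
    by_cases h1 : g i ≤ 1/4
    swap
    · push Not at h1; linarith
    have hm := le_min (clowA i hi h1) (clowB j hj)
    have ui := cup i
    have uj := cup j
    rw [hi] at ui
    rw [hj] at uj
    rcases hor with h | ⟨h, hv⟩
    · have := aux_ratio1 (c i) _ e (g i) he0 he' gi hm (by linarith)
      linarith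
    · have q1 := aux_ratio2 (c j) _ e (g j) he0 he' gj (by linarith [clowB j hj]) hm (by linarith)
      have q2 := win i j hi h1 hj hv
      have q3 := aux_ph (c j) (4 * g j + 4 * g i + 20 * e) (by linarith) (by linarith)
      linarith
  have rAB : ∀ i j, s i = 0 → s j = 1 → r i j ≤ ph (c j) + 100 * e + 20 * (g i + g j) := by
    intro i j hi hj
    apply rAB0 i j hi hj _ (hr3 i j)
    rcases hW i j with ⟨h, -⟩ | h
    · exact Or.inl h
    · exact Or.inr h
  have rBA : ∀ i j, s i = 0 → s j = 1 → r j i ≤ ph (c j) + 100 * e + 20 * (g i + g j) := by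
    intro i j hi hj
    apply rAB0 i j hi hj _ (hr3 j i)
    rw [min_comm]
    rcases hW j i with h | ⟨h, -⟩
    · exact Or.inr h
    · exact Or.inl h
  have rBB : ∀ i j, s i = 1 → s j = 1 →
      r i j ≤ 5 - ph (c i) - ph (c j) + 100 * e + 20 * (g i + g j) := by
    intro i j hi hj
    have gi := hg0 i
    have gj := hg0 j
    have ui := cup i
    have uj := cup j
    rw [hi] at ui
    rw [hj] at uj
    rcases hW i j with ⟨h, -⟩ | ⟨h, -⟩
    · have := aux_BB (c i) (c j) e (g i) he0 he' gi (by linarith) (clowB i hi) (clowB j hj)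
      linarith
    · have := aux_BB (c j) (c i) e (g j) he0 he' gj (by linarith) (clowB j hj) (clowB i hi)
      rw [min_comm] at h
      linarith
  -- combine
  obtain ⟨ψ, hψ⟩ : ∃ ψ : Fin n → ℝ, ψ = fun v => s v * ph (c v) := ⟨_, rfl⟩
  obtain ⟨Φ, hΦ⟩ : ∃ Φ, Φ = ∑ v, p v * ψ v := ⟨_, rfl⟩
  have hΦb : b ≤ Φ := by
    rw [hΦ, hbd]
    refine Finset.sum_le_sum fun v _ => mul_le_mul_of_nonneg_left ?_ (hp v)
    have := ph_ge (c v)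
    rw [hψ]
    rcases hs01 v with h | ⟨h, -⟩ <;> simp [h, this]
  have pt : ∀ i j, r i j ≤ (1 - s i) * (1 - s j) + (1 - s i) * ψ j + ψ i * (1 - s j)
      + 5 * (s i * s j) - ψ i * s j - s i * ψ j + 100 * e + 20 * (g i + g j) := by
    intro i j
    rw [hψ]
    rcases hs01 i with h | ⟨h, -⟩ <;> rcases hs01 j with h' | ⟨h', -⟩ <;> simp only [h, h']
    · linarith [rAA i j h h']
    · linarith [rAB i j h h']
    · linarith [rBA j i h' h]
    · linarith [rBB i j h h']
  have inner : ∀ i, ∑ j, p j * r i j ≤ (1 - s i) * (1 - b) + (1 - s i) * Φ + ψ i * (1 - b)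
      + 5 * (s i * b) - ψ i * b - s i * Φ + 100 * e + 20 * (g i + G) := by
    intro i
    calc ∑ j, p j * r i j ≤ ∑ j, p j * ((1 - s i) * (1 - s j) + (1 - s i) * ψ j + ψ i * (1 - s j)
      + 5 * (s i * s j) - ψ i * s j - s i * ψ j + 100 * e + 20 * (g i + g j)) :=
          Finset.sum_le_sum fun j _ => mul_le_mul_of_nonneg_left (pt i j) (hp j)
      _ = ((1 - s i) + ψ i + 100 * e + 20 * g i) * (∑ j, p j)
          + (-(1 - s i) - ψ i + 5 * s i - ψ i) * (∑ j, p j * s j)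
          + ((1 - s i) - s i) * (∑ j, p j * ψ j) + 20 * (∑ j, p j * g j) := by
          simp only [Finset.mul_sum, ← Finset.sum_add_distrib]
          exact Finset.sum_congr rfl fun v _ => by ring
      _ = _ := by rw [hpsum, ← hbd, ← hΦ, ← hG]; ring
  have total : ∑ i, ∑ j, p i * p j * r i j ≤ (1 - b) * (1 - b) + (1 - b) * Φ + Φ * (1 - b)
      + 5 * (b * b) - Φ * b - b * Φ + 100 * e + 20 * (G + G) := by
    calc ∑ i, ∑ j, p i * p j * r i j = ∑ i, p i * ∑ j, p j * r i j := by
          refine Finset.sum_congr rfl fun i _ => ?_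
          rw [Finset.mul_sum]
          exact Finset.sum_congr rfl fun v _ => by ring
      _ ≤ ∑ i, p i * ((1 - s i) * (1 - b) + (1 - s i) * Φ + ψ i * (1 - b)
      + 5 * (s i * b) - ψ i * b - s i * Φ + 100 * e + 20 * (g i + G)) :=
          Finset.sum_le_sum fun j _ => mul_le_mul_of_nonneg_left (inner j) (hp j)
      _ = ((1 - b) + Φ + 100 * e + 20 * G) * (∑ j, p j)
          + (-(1 - b) - Φ + 5 * b - Φ) * (∑ j, p j * s j)
          + ((1 - b) - b) * (∑ j, p j * ψ j) + 20 * (∑ j, p j * g j) := by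
          simp only [Finset.mul_sum, ← Finset.sum_add_distrib]
          exact Finset.sum_congr rfl fun v _ => by ring
      _ = _ := by rw [hpsum, ← hbd, ← hΦ, ← hG]; ring
  have fin1 : ∑ i, ∑ j, p i * p j * r i j ≤ 3/2 + 150 * e := by
    have hbe : b - 1/2 ≤ e := by linarith
    nlinarith [mul_nonneg (sub_nonneg.2 hb2) (sub_nonneg.2 hΦb)]
  have hsq : δ ≤ Real.sqrt δ / 10 := by
    have h1 : Real.sqrt δ ≤ 1/10 := by
      rw [Real.sqrt_le_left (by norm_num)]; linarith
    have h2 := Real.mul_self_sqrt hδ0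
    nlinarith [Real.sqrt_nonneg δ]
  linarith


lemma votes_eq {n : ℕ} (M : FinMetric n) (p : Fin n → ℝ) (i j : Fin n) :
    mvotes M p i j = ∑ v, p v * (if M.d i v < M.d j v then (1:ℝ) else 0) := by
  unfold mvotes
  rw [Finset.sum_filter]
  exact Finset.sum_congr rfl fun v _ => by split_ifs <;> simp

lemma win_ge {n : ℕ} (M : FinMetric n) (p : Fin n → ℝ) (hp : ∀ i, 0 ≤ p i) (hpsum : ∑ i, p i = 1)
    (D : ℝ) (hD : 0 < D) (i j : Fin n) :
    (mwin M p i j = i ∧ 1/2 ≤ ∑ v, p v * (if M.d i v / D ≤ M.d j v / D then (1:ℝ) else 0)) ∨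
    (mwin M p i j = j ∧ 1/2 ≤ ∑ v, p v * (if M.d j v / D ≤ M.d i v / D then (1:ℝ) else 0)) := by
  simp only [div_le_div_iff_of_pos_right hD]
  unfold mwin
  by_cases h : 1/2 < mvotes M p i j
  · left
    refine ⟨by rw [if_pos h], h.le.trans ?_⟩
    rw [votes_eq]
    refine Finset.sum_le_sum fun v _ => mul_le_mul_of_nonneg_left ?_ (hp v)
    split_ifs <;> first | linarith | norm_num
  · right
    refine ⟨by rw [if_neg h], ?_⟩
    push Not at h
    rw [votes_eq] at h
    have : ∑ v, p v * (if M.d i v < M.d j v then (1:ℝ) else 0)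
        + ∑ v, p v * (if M.d j v ≤ M.d i v then (1:ℝ) else 0) = 1 := by
      rw [← Finset.sum_add_distrib]; refine Eq.trans ?_ hpsum
      refine Finset.sum_congr rfl fun v _ => ?_
      split_ifs <;> first | linarith | simp
    linarith

lemma opt_min {n : ℕ} (M : FinMetric n) (p : Fin n → ℝ) (i j : Fin n) :
    mcost M p (mopt M p i j) = min (mcost M p i) (mcost M p j) := by
  unfold mopt
  split_ifs with h
  · rw [min_eq_left h.le]
  · rw [min_eq_right (not_lt.1 h)]

/-- let `(D, p, p)` be a general-position instance whose candidate
distribution equals its voter distribution, let `δ ≤ 1/100`, and suppose the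
maximum pairwise distortion equals `3 - δ`.  Then the expected distortion is at
most `3/2 + 9·√δ`. -/
theorem near_extremal_pair_implies_small_distortion
    (n : ℕ) (M : FinMetric n) (p : Fin n → ℝ)
    (hp : ∀ i, 0 ≤ p i) (hpsum : ∑ i, p i = 1)
    (hgen : MGenPos M p)
    (δ : ℝ) (hδ0 : 0 ≤ δ) (hδ : δ ≤ 1/100)
    (hub : ∀ i j : Fin n, mr M p i j ≤ 3 - δ)
    (hattained : ∃ i j : Fin n, mr M p i j = 3 - δ) :
    msocial M p p ≤ 3/2 + 9 * Real.sqrt δ := by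
  have dnn : ∀ i j, 0 ≤ M.d i j := by
    intro i j
    by_cases h : i = j
    · rw [h, M.refl]
    · exact (M.pos i j h).le
  have key : ∃ A B : Fin n, A ≠ B ∧ mcost M p B = (3 - δ) * mcost M p A ∧
      ∀ D : ℝ, 0 < D → 1/2 ≤ ∑ v, p v * (if M.d B v / D ≤ M.d A v / D then (1:ℝ) else 0) := by
    obtain ⟨i, j, hij⟩ := hattained
    have hn0 : mcost M p (mopt M p i j) ≠ 0 := by
      intro h
      unfold mr at hij
      rw [h, div_zero] at hij
      linarith
    have hne : mopt M p i j ≠ mwin M p i j := by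
      intro h
      unfold mr at hij
      rw [← h, div_self hn0] at hij
      linarith
    refine ⟨mopt M p i j, mwin M p i j, hne, ?_, ?_⟩
    · unfold mr at hij
      rwa [div_eq_iff hn0] at hij
    · intro D hD
      have ho : mopt M p i j = i ∨ mopt M p i j = j := by
        unfold mopt; split_ifs <;> simp
      rcases win_ge M p hp hpsum D hD i j with ⟨h, h'⟩ | ⟨h, h'⟩ <;> rcases ho with h2 | h2
      · exact absurd (h2.trans h.symm) hne
      · rw [h, h2]; exact h'
      · rw [h, h2]; exact h'
      · exact absurd (h2.trans h.symm) hne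
  obtain ⟨A, B, hne, hcAB, hbb⟩ := key
  have hD := M.pos A B hne
  obtain ⟨D, hDd⟩ : ∃ D, D = M.d A B := ⟨_, rfl⟩
  rw [← hDd] at hD
  unfold msocial
  refine core (fun i j => M.d i j / D) p (fun i => mcost M p i / D) (mr M p) hp hpsum
    (fun i j => div_nonneg (dnn i j) hD.le) (fun i j => by simp only [M.symm i j])
    (fun i j k => ?_) (fun i => ?_) (fun i j => (hub i j).trans (by linarith)) (fun i j => ?_)
    A B ?_ δ hδ0 hδ ?_ (hbb D hD)
  · simp only [← add_div]
    exact div_le_div_of_nonneg_right (M.triangle i j k) hD.le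
  · simp only [mcost, Finset.sum_div, mul_div_assoc]
  · have hm : min (mcost M p i / D) (mcost M p j / D) = min (mcost M p i) (mcost M p j) / D :=
      (min_div_div_right hD.le _ _)
    simp only [hm, div_div_div_cancel_right₀ hD.ne']
    unfold mr
    rw [opt_min]
    rcases win_ge M p hp hpsum D hD i j with ⟨h, h'⟩ | ⟨h, h'⟩
    · left; exact ⟨by rw [h], h'⟩
    · right; exact ⟨by rw [h], h'⟩
  · simp only [← hDd, div_self hD.ne']
  · simp only [hcAB, mul_div_assoc]
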